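/- Let M = (M_j)_{j≥0} be a strongly regular sequence and let γ be a real number with 0 < γ < γ(M) and γ < 2. Then the Borel map on the Beurling class is surjective: for every complex sequence λ = (λ_j)_{j∈ℕ} such that for every σ > 0 there is C_σ with |λ_j| ≤ C_σ σ^j j! M_j for all j, there exists a holomorphic function f on S_γ such that for every σ > 0 one has sup{|f^{(j)}(z)|/(σ^j j! M_j) : j ∈ ℕ, z ∈ S_γ} < ∞, and for every j the derivative f^{(j)} tends to λ_j at the origin along S_γ. -/

import Mathlib

noncomputable section

open Filter MeasureTheory
open scoped Topology

def StronglyRegularWith (M : ℕ → ℝ) (A : ℝ) : Prop :=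
  (∀ j, 0 < M j) ∧ M 0 = 1 ∧ Monotone M ∧
  (∀ j : ℕ, M (j + 1) * M (j + 1) ≤ M j * M (j + 2)) ∧
  1 ≤ A ∧
  (∀ j k : ℕ, M (j + k) ≤ A ^ (j + k) * (M j * M k)) ∧
  (∀ ℓ N : ℕ, ∑ j ∈ Finset.range N,
      M (ℓ + j) / (((ℓ + j : ℕ) + 1 : ℝ) * M (ℓ + j + 1)) ≤ A * (M ℓ / M (ℓ + 1)))

def StronglyRegular (M : ℕ → ℝ) : Prop := ∃ A : ℝ, StronglyRegularWith M A

noncomputable def hfn (M : ℕ → ℝ) (t : ℝ) : ℝ :=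
  if t = 0 then 0 else ⨅ j : ℕ, t ^ j * M j

def PropertyP (M : ℕ → ℝ) (γ : ℝ) : Prop :=
  ∃ (m' : ℕ → ℝ) (a : ℝ), 1 ≤ a ∧ (∀ j, 0 < m' j) ∧
    (Monotone fun j : ℕ => ((j : ℝ) + 1) ^ (-γ) * m' j) ∧
    (∀ j : ℕ, a⁻¹ * (M (j + 1) / M j) ≤ m' j ∧ m' j ≤ a * (M (j + 1) / M j))

noncomputable def growthIndex (M : ℕ → ℝ) : ℝ :=
  sSup {γ : ℝ | 0 < γ ∧ PropertyP M γ}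

def Sector (γ : ℝ) : Set ℂ :=
  {z : ℂ | z ≠ 0 ∧ |Complex.arg z| < γ * Real.pi / 2}

noncomputable def mixedPartial {n : ℕ} {F : Type*} [NormedAddCommGroup F] [NormedSpace ℝ F]
    (S : Set (EuclideanSpace ℝ (Fin n))) (f : EuclideanSpace ℝ (Fin n) → F)
    (k : ℕ) (e : Fin k → Fin n) (x : EuclideanSpace ℝ (Fin n)) : F :=
  iteratedFDerivWithin ℝ k f S x fun i => EuclideanSpace.single (e i) 1

/-- The open horizontal strip of half-width `ρ`. -/
def Strip (ρ : ℝ) : Set ℂ := {ζ : ℂ | |ζ.im| < ρ}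

lemma isOpen_strip (ρ : ℝ) : IsOpen (Strip ρ) :=
  isOpen_lt (by fun_prop) continuous_const

lemma ofReal_sub_mem_strip {ρ : ℝ} {ζ : ℂ} (hζ : ζ ∈ Strip ρ) (x : ℝ) : (x : ℂ) - ζ ∈ Strip ρ := by
  simpa [Strip] using hζ

lemma convex_strip (ρ : ℝ) : Convex ℝ (Strip ρ) := by
  have : Strip ρ = Complex.imLm ⁻¹' Set.Ioo (-ρ) ρ := by
    ext ζ; simp [Strip, abs_lt]
  rw [this]
  exact (convex_Ioo _ _).linear_preimage _

lemma integrable_exp_neg_abs : Integrable fun x : ℝ => Real.exp (-|x|) := by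
  rw [← integrableOn_univ, ← Set.Iic_union_Ioi (a := (0 : ℝ))]
  refine IntegrableOn.union ?_ ?_
  · refine (integrableOn_exp_Iic 0).congr_fun (fun x hx => ?_) measurableSet_Iic
    simp [abs_of_nonpos (Set.mem_Iic.1 hx)]
  · refine (integrableOn_exp_neg_Ioi 0).congr_fun (fun x hx => ?_) measurableSet_Ioi
    simp [abs_of_pos (Set.mem_Ioi.1 hx)]

lemma norm_deriv_le_exp_neg_abs_re {ρ C r : ℝ} {h : ℂ → ℂ} (hd : DifferentiableOn ℂ h (Strip ρ))
    (hb : ∀ ζ ∈ Strip ρ, ‖h ζ‖ ≤ C * Real.exp (-|ζ.re|)) (hr : 0 < r) {ζ : ℂ}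
    (hζ : |ζ.im| + r < ρ) :
    ‖deriv h ζ‖ ≤ C * Real.exp (r - |ζ.re|) / r := by
  have hsub : Metric.closedBall ζ r ⊆ Strip ρ := by
    intro w hw
    have h1 : |(w - ζ).im| ≤ r := (Complex.abs_im_le_norm _).trans (by simpa [dist_eq_norm] using hw)
    have h2 : |w.im| ≤ |(w - ζ).im| + |ζ.im| := by
      simpa using abs_add_le (w - ζ).im ζ.im
    simp only [Strip, Set.mem_ofPred_eq]; linarith
  have hC : 0 ≤ C := by
    have := (norm_nonneg _).trans (hb ζ (hsub (Metric.mem_closedBall_self hr.le)))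
    exact nonneg_of_mul_nonneg_left this (Real.exp_pos _)
  refine Complex.norm_deriv_le_of_forall_mem_sphere_norm_le hr
    (hd.diffContOnCl_ball hsub) fun w hw => ?_
  have hw' := Metric.sphere_subset_closedBall hw
  refine (hb w (hsub hw')).trans ?_
  have h1 : |(w - ζ).re| ≤ r := (Complex.abs_re_le_norm _).trans (by simpa [dist_eq_norm] using hw')
  have h2 : |ζ.re| ≤ |(w - ζ).re| + |w.re| := by
    simpa [abs_sub_comm] using abs_sub_le ζ.re w.re 0
  gcongr; linarith

lemma integrable_convolution {ρ C B : ℝ} {h : ℂ → ℂ} (hd : DifferentiableOn ℂ h (Strip ρ))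
    (hb : ∀ ζ ∈ Strip ρ, ‖h ζ‖ ≤ C * Real.exp (-|ζ.re|)) {g : ℝ → ℂ} (hg : Measurable g)
    (hgB : ∀ x, ‖g x‖ ≤ B) {ζ : ℂ} (hζ : ζ ∈ Strip ρ) :
    Integrable fun x : ℝ => h (x - ζ) * g x := by
  have hcont : Continuous fun x : ℝ => h (x - ζ) :=
    hd.continuousOn.comp_continuous (by fun_prop) fun x => ofReal_sub_mem_strip hζ x
  refine Integrable.mul_bdd (c := B) ?_ hg.aestronglyMeasurable (ae_of_all _ hgB)
  refine Integrable.mono' ((integrable_exp_neg_abs.comp_sub_right ζ.re).const_mul C)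
    hcont.aestronglyMeasurable (ae_of_all _ fun x => ?_)
  simpa using hb _ (ofReal_sub_mem_strip hζ x)

lemma differentiableOn_convolution {ρ C B : ℝ} {h : ℂ → ℂ} (hd : DifferentiableOn ℂ h (Strip ρ))
    (hb : ∀ ζ ∈ Strip ρ, ‖h ζ‖ ≤ C * Real.exp (-|ζ.re|)) {g : ℝ → ℂ} (hg : Measurable g)
    (hgB : ∀ x, ‖g x‖ ≤ B) :
    DifferentiableOn ℂ (fun ζ => ∫ x : ℝ, h (x - ζ) * g x) (Strip ρ) := by
  intro ζ₀ hζ₀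
  have hζ₀' : |ζ₀.im| < ρ := hζ₀
  obtain ⟨r, hr, hr2⟩ : ∃ r > 0, |ζ₀.im| + 2 * r < ρ :=
    ⟨(ρ - |ζ₀.im|) / 3, by linarith, by linarith⟩
  have hB : 0 ≤ B := (norm_nonneg _).trans (hgB 0)
  have hC : 0 ≤ C := nonneg_of_mul_nonneg_left ((norm_nonneg _).trans (hb ζ₀ hζ₀)) (Real.exp_pos _)
  have him : ∀ ζ ∈ Metric.ball ζ₀ r, |ζ.im| + r < ρ := fun ζ hζ => by
    have h1 : |(ζ - ζ₀).im| ≤ r :=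
      (Complex.abs_im_le_norm _).trans (by simpa [dist_eq_norm] using (Metric.mem_ball.1 hζ).le)
    have h2 : |ζ.im| ≤ |(ζ - ζ₀).im| + |ζ₀.im| := by
      simpa using abs_add_le (ζ - ζ₀).im ζ₀.im
    linarith
  have hmem : ∀ ζ ∈ Metric.ball ζ₀ r, ζ ∈ Strip ρ := fun ζ hζ => by
    have := him ζ hζ
    simp only [Strip, Set.mem_ofPred_eq]; linarith
  have key := hasDerivAt_integral_of_dominated_loc_of_deriv_le (μ := volume)
    (F := fun (ζ : ℂ) (x : ℝ) => h (x - ζ) * g x)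
    (F' := fun (ζ : ℂ) (x : ℝ) => -deriv h (x - ζ) * g x)
    (bound := fun x => C * Real.exp (2 * r + |ζ₀.re|) / r * B * Real.exp (-|x|))
    (Metric.ball_mem_nhds ζ₀ hr) ?_ (integrable_convolution hd hb hg hgB hζ₀) ?_ ?_ ?_ ?_
  · exact key.2.differentiableAt.differentiableWithinAt
  · filter_upwards [Metric.ball_mem_nhds ζ₀ hr] with ζ hζ
    exact (integrable_convolution hd hb hg hgB (hmem ζ hζ)).aestronglyMeasurable
  · have hcont : Continuous fun x : ℝ => deriv h (x - ζ₀) :=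
      (hd.deriv (isOpen_strip ρ)).continuousOn.comp_continuous (by fun_prop)
        fun x => ofReal_sub_mem_strip hζ₀ x
    exact hcont.neg.aestronglyMeasurable.mul hg.aestronglyMeasurable
  · refine ae_of_all _ fun x ζ hζ => ?_
    rw [norm_mul, norm_neg]
    have h0 : |((x : ℂ) - ζ).im| + r < ρ := by simpa using him ζ hζ
    have h1 := norm_deriv_le_exp_neg_abs_re hd hb hr h0
    have h2 : |(ζ - ζ₀).re| ≤ r :=
      (Complex.abs_re_le_norm _).trans (by simpa [dist_eq_norm] using (Metric.mem_ball.1 hζ).le)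
    have h3 : |x| ≤ |((x : ℂ) - ζ).re| + |(ζ - ζ₀).re| + |ζ₀.re| := by
      have := (abs_add_le (((x : ℂ) - ζ).re + (ζ - ζ₀).re) ζ₀.re).trans
        (add_le_add_left (abs_add_le _ _) _)
      simpa using this
    calc ‖deriv h (x - ζ)‖ * ‖g x‖
        ≤ (C * (Real.exp (2 * r + |ζ₀.re|) * Real.exp (-|x|)) / r) * B := by
          refine mul_le_mul (h1.trans ?_) (hgB x) (norm_nonneg _) (by positivity)
          rw [← Real.exp_add]
          gcongr
          linarith
      _ = _ := by ring
  · exact integrable_exp_neg_abs.const_mul _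
  · refine ae_of_all _ fun x ζ hζ => ?_
    have h1 : HasDerivAt h (deriv h (x - ζ)) (x - ζ) :=
      (hd.differentiableAt ((isOpen_strip ρ).mem_nhds
        (ofReal_sub_mem_strip (hmem ζ hζ) x))).hasDerivAt
    have h2 : HasDerivAt (fun ζ : ℂ => (x : ℂ) - ζ) (-1) ζ := by
      simpa using (hasDerivAt_id ζ).const_sub (x : ℂ)
    simpa using (h1.comp ζ h2).mul_const (g x)

lemma integral_sub_eq_integral {ρ C : ℝ} {h : ℂ → ℂ} (hd : DifferentiableOn ℂ h (Strip ρ))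
    (hb : ∀ ζ ∈ Strip ρ, ‖h ζ‖ ≤ C * Real.exp (-|ζ.re|)) {ζ : ℂ} (hζ : ζ ∈ Strip ρ) :
    ∫ x : ℝ, h (x - ζ) = ∫ x : ℝ, h x := by
  have hρ : 0 < ρ := (abs_nonneg _).trans_lt hζ
  have hD : DifferentiableOn ℂ (fun ζ => ∫ x : ℝ, h (x - ζ)) (Strip ρ) := by
    simpa using differentiableOn_convolution hd hb (g := fun _ => 1) (B := 1) measurable_const
      (by simp)
  have hderiv : Set.EqOn (deriv fun ζ => ∫ x : ℝ, h (x - ζ)) 0 (Strip ρ) := by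
    intro w hw
    have h1 := (hD.differentiableAt ((isOpen_strip ρ).mem_nhds hw)).hasDerivAt
    have h2 : HasDerivAt (fun t : ℝ => w + t) 1 0 := by
      simpa using (Complex.ofRealCLM.hasDerivAt (x := 0)).const_add w
    have h3 := HasDerivAt.scomp_of_eq (0 : ℝ) h1 h2 (by simp)
    have h4 : ((fun ζ => ∫ x : ℝ, h (x - ζ)) ∘ fun t : ℝ => w + t) =
        fun _ => ∫ x : ℝ, h (x - w) := by
      funext t
      have := integral_sub_right_eq_self (μ := volume) (fun x : ℝ => h (x - w)) t
      simp only [Function.comp_apply, ← this]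
      congr 1; funext x; congr 1; push_cast; ring
    rw [h4] at h3
    simpa using h3.unique (hasDerivAt_const _ _)
  have := (isOpen_strip ρ).is_const_of_deriv_eq_zero (convex_strip ρ).isPreconnected hD hderiv hζ
    (show (0 : ℂ) ∈ Strip ρ by simpa [Strip] using hρ)
  simpa using this

lemma exists_antitone_majorant {β D : ℕ → ℝ} (hβ : ∀ k, 0 ≤ β k) (hβ0 : Tendsto β atTop (𝓝 0))
    (hD : ∀ j, 0 < D j) (hDmono : Monotone D) (hDtop : Tendsto D atTop atTop) :
    ∃ θ : ℕ → ℝ, (∀ j, β j ≤ θ j) ∧ Antitone θ ∧ Monotone (fun j => D j * θ j) ∧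
      Tendsto θ atTop (𝓝 0) := by
  obtain ⟨b, hb⟩ := hβ0.bddAbove_range
  have hb' : ∀ k, β k ≤ b := fun k => hb ⟨k, rfl⟩
  have hb0 : 0 ≤ b := (hβ 0).trans (hb' 0)
  have hm0 : ∀ j k, 0 ≤ min 1 (D k / D j) := fun j k =>
    le_min zero_le_one (div_pos (hD k) (hD j)).le
  have hbdd : ∀ j, BddAbove (Set.range fun k => β k * min 1 (D k / D j)) := fun j => by
    refine ⟨b, ?_⟩
    rintro _ ⟨k, rfl⟩
    exact (mul_le_of_le_one_right (hβ k) (min_le_left _ _)).trans (hb' k)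
  have hθ : ∀ j k, β k * min 1 (D k / D j) ≤ ⨆ k, β k * min 1 (D k / D j) := fun j k =>
    le_ciSup (hbdd j) k
  refine ⟨fun j => ⨆ k, β k * min 1 (D k / D j), fun j => ?_, fun i j hij => ?_,
    fun i j hij => ?_, ?_⟩
  · simpa [div_self (hD j).ne'] using hθ j j
  · refine ciSup_le fun k => le_trans ?_ (hθ i k)
    refine mul_le_mul_of_nonneg_left (min_le_min_left _ ?_) (hβ k)
    exact div_le_div_of_nonneg_left (hD k).le (hD i) (hDmono hij)
  · dsimp only
    rw [← le_div_iff₀' (hD i)]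
    refine ciSup_le fun k => ?_
    rw [le_div_iff₀' (hD i)]
    refine le_trans ?_ (mul_le_mul_of_nonneg_left (hθ j k) (hD j).le)
    have h : ∀ l, D l * (β k * min 1 (D k / D l)) = β k * min (D l) (D k) := fun l => by
      rw [mul_left_comm, mul_min_of_nonneg _ _ (hD l).le, mul_one, mul_div_cancel₀ _ (hD l).ne']
    rw [h, h]
    exact mul_le_mul_of_nonneg_left (min_le_min_right _ (hDmono hij)) (hβ k)
  · refine tendsto_order.2 ⟨fun c hc => Eventually.of_forall fun j => hc.trans_le
      ((mul_nonneg (hβ j) (hm0 j j)).trans (hθ j j)), fun ε hε => ?_⟩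
    obtain ⟨K, hK⟩ := eventually_atTop.1 ((tendsto_order.1 hβ0).2 (ε / 2) (by linarith))
    have h2 : Tendsto (fun j => b * D K / D j) atTop (𝓝 0) := hDtop.const_div_atTop _
    filter_upwards [(tendsto_order.1 h2).2 (ε / 2) (by linarith)] with j hj
    refine (ciSup_le fun k => ?_).trans_lt (half_lt_self hε)
    rcases le_total K k with hk | hk
    · exact (mul_le_of_le_one_right (hβ k) (min_le_left _ _)).trans (hK k hk).le
    · refine le_trans ?_ hj.le
      rw [mul_div_assoc]
      refine mul_le_mul (hb' k) ((min_le_right _ _).trans ?_) (hm0 j k) hb0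
      exact div_le_div_of_nonneg_right (hDmono hk) (hD j).le

lemma exists_prod_range_le_mul_pow {θ : ℕ → ℝ} (hθ : ∀ k, 0 < θ k)
    (hθ0 : Tendsto θ atTop (𝓝 0)) {σ : ℝ} (hσ : 0 < σ) :
    ∃ C : ℝ, ∀ j, ∏ k ∈ Finset.range j, θ k ≤ C * σ ^ j := by
  obtain ⟨K, hK⟩ := eventually_atTop.1 ((tendsto_order.1 hθ0).2 σ hσ)
  set u : ℕ → ℝ := fun j => (∏ k ∈ Finset.range j, θ k) / σ ^ j with hu
  have hu0 : ∀ j, 0 ≤ u j := fun j =>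
    div_nonneg (Finset.prod_nonneg fun k _ => (hθ k).le) (pow_pos hσ j).le
  have hsucc : ∀ j, u (j + 1) = u j * (θ j / σ) := fun j => by
    simp only [hu, Finset.prod_range_succ, pow_succ]; field_simp
  refine ⟨∑ i ∈ Finset.range (K + 1), u i, fun j => ?_⟩
  rw [← div_le_iff₀ (pow_pos hσ j)]
  change u j ≤ _
  have hle : ∀ i ≤ K, u i ≤ ∑ i ∈ Finset.range (K + 1), u i := fun i hi =>
    Finset.single_le_sum (f := u) (fun i _ => hu0 i) (Finset.mem_range.2 (by omega))
  rcases le_total j K with hj | hj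
  · exact hle j hj
  · refine le_trans ?_ (hle K le_rfl)
    induction j, hj using Nat.le_induction with
    | base => exact le_rfl
    | succ j hj ih =>
      rw [hsucc]
      refine (mul_le_of_le_one_right (hu0 j) ?_).trans ih
      rw [div_le_one hσ]; exact (hK j hj).le

lemma prod_range_quotient {M : ℕ → ℝ} (hM : ∀ j, 0 < M j) (hM0 : M 0 = 1) (j : ℕ) :
    ∏ k ∈ Finset.range j, M (k + 1) / M k = M j := by
  induction j with
  | zero => simp [hM0]
  | succ j ih => rw [Finset.prod_range_succ, ih, mul_div_cancel₀ _ (hM j).ne']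

/-- A sequence of Beurling type for `M` is of Roumieu type for some sequence, given here by its
quotients `n`, that is much smaller than `M` and retains the growth of the quotients of `M`. -/
lemma exists_intermediate_quotients {M : ℕ → ℝ} {A γ γ' : ℝ} (hM : ∀ j, 0 < M j) (hM0 : M 0 = 1)
    (hA : 1 ≤ A) (hMA : ∀ j k : ℕ, M (j + k) ≤ A ^ (j + k) * (M j * M k))
    (hP : PropertyP M γ') (hγ : γ < γ') {a : ℕ → ℂ}
    (ha : ∀ σ : ℝ, 0 < σ → ∃ C : ℝ, ∀ j : ℕ, ‖a j‖ ≤ C * σ ^ j * M j) :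
    ∃ n : ℕ → ℝ, (∀ k, 0 < n k) ∧ (Monotone fun k : ℕ => ((k : ℝ) + 1) ^ (-γ) * n k) ∧
      (∃ C, 1 ≤ C ∧ ∀ k, n k ≤ C ^ (k + 1)) ∧
      (∃ C B : ℝ, 0 < C ∧ 1 ≤ B ∧ ∀ j, ‖a j‖ ≤ C * B ^ j * ∏ k ∈ Finset.range j, n k) ∧
      ∀ σ : ℝ, 0 < σ → ∃ C : ℝ, ∀ j, ∏ k ∈ Finset.range j, n k ≤ C * σ ^ j * M j := by
  obtain ⟨m', b, hb, hm'0, hm'mono, hm'⟩ := hP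
  have hb0 : 0 < b := by linarith
  set β : ℕ → ℝ := fun j => (‖a j‖ / M j) ^ ((j : ℝ)⁻¹) + 1 / ((j : ℝ) + 1) with hβdef
  have hpos1 : ∀ j : ℕ, 0 < (j : ℝ) + 1 := fun j => by positivity
  have hα0 : ∀ j, 0 ≤ ‖a j‖ / M j := fun j => div_nonneg (norm_nonneg _) (hM j).le
  have hβpos : ∀ j, 0 < β j := fun j =>
    add_pos_of_nonneg_of_pos (Real.rpow_nonneg (hα0 j) _) (one_div_pos.2 (hpos1 j))
  have hβ0 : Tendsto β atTop (𝓝 0) := by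
    rw [← add_zero (0 : ℝ)]
    refine Tendsto.add ?_ tendsto_one_div_add_atTop_nhds_zero_nat
    refine tendsto_order.2 ⟨fun c hc => Eventually.of_forall fun j => hc.trans_le
      (Real.rpow_nonneg (hα0 j) _), fun ε hε => ?_⟩
    obtain ⟨C, hC⟩ := ha (ε / 4) (by linarith)
    have h1 : ∀ᶠ j : ℕ in atTop, |C| ≤ 2 ^ j :=
      (tendsto_pow_atTop_atTop_of_one_lt (one_lt_two : (1 : ℝ) < 2)).eventually_ge_atTop _
    filter_upwards [h1, eventually_ge_atTop 1] with j hj hj1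
    have hj0 : (0 : ℝ) < j := by exact_mod_cast hj1
    have h2 : ‖a j‖ / M j ≤ (ε / 2) ^ j := by
      rw [div_le_iff₀ (hM j)]
      refine (hC j).trans (mul_le_mul_of_nonneg_right ?_ (hM j).le)
      calc C * (ε / 4) ^ j ≤ 2 ^ j * (ε / 4) ^ j := by
            gcongr; exact (le_abs_self C).trans hj
        _ = (ε / 2) ^ j := by rw [← mul_pow]; congr 1; ring
    calc (‖a j‖ / M j) ^ ((j : ℝ)⁻¹) ≤ ((ε / 2) ^ j) ^ ((j : ℝ)⁻¹) :=
          Real.rpow_le_rpow (hα0 j) h2 (by positivity)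
      _ = ε / 2 := Real.pow_rpow_inv_natCast (by positivity) (by omega)
      _ < ε := half_lt_self hε
  have hδ : 0 < γ' - γ := by linarith
  obtain ⟨θ, hβθ, hθanti, hθmono, hθ0⟩ := exists_antitone_majorant
    (D := fun j : ℕ => ((j : ℝ) + 1) ^ (γ' - γ)) (fun k => (hβpos k).le) hβ0
    (fun j => Real.rpow_pos_of_pos (hpos1 j) _)
    (fun i j hij => Real.rpow_le_rpow (hpos1 i).le
      (by have : (i : ℝ) ≤ j := by exact_mod_cast hij
          linarith) hδ.le)
    ((tendsto_rpow_atTop hδ).comp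
      (tendsto_natCast_atTop_atTop.atTop_add tendsto_const_nhds))
  have hθpos : ∀ j, 0 < θ j := fun j => (hβpos j).trans_le (hβθ j)
  have hprod : ∀ j, ∏ k ∈ Finset.range j, m' k * θ k =
      (∏ k ∈ Finset.range j, m' k) * ∏ k ∈ Finset.range j, θ k := fun j => Finset.prod_mul_distrib
  have hmM : ∀ j, ∏ k ∈ Finset.range j, m' k ≤ b ^ j * M j := fun j => by
    rw [← prod_range_quotient hM hM0 j]
    refine (Finset.prod_le_prod (fun k _ => (hm'0 k).le) fun k _ => (hm' k).2).trans_eq ?_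
    rw [Finset.prod_mul_distrib, Finset.prod_const, Finset.card_range]
  have hMm : ∀ j, M j ≤ b ^ j * ∏ k ∈ Finset.range j, m' k := fun j => by
    rw [← prod_range_quotient hM hM0 j, ← Finset.card_range j, ← Finset.prod_const,
      Finset.card_range, ← Finset.prod_mul_distrib]
    refine Finset.prod_le_prod (fun k _ => (div_pos (hM _) (hM _)).le) fun k _ => ?_
    have := (hm' k).1
    rwa [inv_mul_le_iff₀ hb0] at this
  refine ⟨fun k => m' k * θ k, fun k => mul_pos (hm'0 k) (hθpos k), ?_, ?_, ?_, ?_⟩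
  · have heq : (fun k : ℕ => ((k : ℝ) + 1) ^ (-γ) * (m' k * θ k)) = fun k : ℕ =>
        (((k : ℝ) + 1) ^ (-γ') * m' k) * (((k : ℝ) + 1) ^ (γ' - γ) * θ k) := by
      funext k
      rw [show -γ = -γ' + (γ' - γ) by ring, Real.rpow_add (hpos1 k)]
      ring
    rw [heq]
    exact hm'mono.mul hθmono
      (fun k => mul_nonneg (Real.rpow_nonneg (hpos1 k).le _) (hm'0 k).le)
      (fun k => mul_nonneg (Real.rpow_nonneg (hpos1 k).le _) (hθpos k).le)
  · refine ⟨max 1 (b * M 1 * θ 0) * A, ?_, fun k => ?_⟩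
    · exact one_le_mul_of_one_le_of_one_le (le_max_left _ _) hA
    · have h1 : M (k + 1) / M k ≤ A ^ (k + 1) * M 1 := by
        rw [div_le_iff₀ (hM k)]
        calc _ ≤ _ := hMA k 1
          _ = _ := by ring
      calc m' k * θ k ≤ (b * (A ^ (k + 1) * M 1)) * θ 0 := by
            refine mul_le_mul ((hm' k).2.trans ?_) (hθanti (Nat.zero_le k)) (hθpos k).le ?_
            · gcongr
            · have := (hM 1).le; positivity
        _ = (b * M 1 * θ 0) * A ^ (k + 1) := by ring
        _ ≤ (max 1 (b * M 1 * θ 0)) ^ (k + 1) * A ^ (k + 1) := by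
            gcongr
            exact (le_max_right _ _).trans (le_self_pow₀ (le_max_left _ _) (by omega))
        _ = _ := by rw [mul_pow]
  · refine ⟨‖a 0‖ + 1, b, by positivity, hb, fun j => ?_⟩
    rcases Nat.eq_zero_or_pos j with rfl | hj
    · simp
    · have h1 : ‖a j‖ ≤ θ j ^ j * M j := by
        rw [← div_le_iff₀ (hM j)]
        calc ‖a j‖ / M j = ((‖a j‖ / M j) ^ ((j : ℝ)⁻¹)) ^ j :=
              (Real.rpow_inv_natCast_pow (hα0 j) (by omega)).symm
          _ ≤ θ j ^ j := by
              refine pow_le_pow_left₀ (Real.rpow_nonneg (hα0 j) _) (le_trans ?_ (hβθ j)) j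
              exact le_add_of_nonneg_right (one_div_pos.2 (hpos1 j)).le
      have h2 : θ j ^ j ≤ ∏ k ∈ Finset.range j, θ k := by
        conv_lhs => rw [← Finset.card_range j]
        rw [← Finset.prod_const]
        refine Finset.prod_le_prod (fun _ _ => (hθpos _).le) fun k hk => ?_
        rw [Finset.card_range]
        exact hθanti (Finset.mem_range.1 hk).le
      have h0 : 0 ≤ ∏ k ∈ Finset.range j, m' k := Finset.prod_nonneg fun k _ => (hm'0 k).le
      have h3 : 0 ≤ ∏ k ∈ Finset.range j, θ k := Finset.prod_nonneg fun k _ => (hθpos k).le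
      calc ‖a j‖ ≤ (∏ k ∈ Finset.range j, θ k) * (b ^ j * ∏ k ∈ Finset.range j, m' k) :=
            h1.trans (mul_le_mul h2 (hMm j) (hM j).le h3)
        _ = 1 * b ^ j * ∏ k ∈ Finset.range j, m' k * θ k := by rw [hprod]; ring
        _ ≤ (‖a 0‖ + 1) * b ^ j * ∏ k ∈ Finset.range j, m' k * θ k := by
            rw [hprod]
            gcongr
            linarith [norm_nonneg (a 0)]
  · intro σ hσ
    obtain ⟨C, hC⟩ := exists_prod_range_le_mul_pow hθpos hθ0 (div_pos hσ hb0)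
    refine ⟨C, fun j => ?_⟩
    rw [hprod]
    have h3 : 0 ≤ ∏ k ∈ Finset.range j, θ k := Finset.prod_nonneg fun k _ => (hθpos k).le
    calc _ ≤ (b ^ j * M j) * (C * (σ / b) ^ j) :=
          mul_le_mul (hmM j) (hC j) h3 (by have := (hM j).le; positivity)
      _ = _ := by rw [div_pow]; field_simp

lemma rpow_neg_add_one_le {δ k : ℝ} (hδ : 0 < δ) (hk : 0 < k) :
    δ * (k + 1) ^ (-(δ + 1)) ≤ k ^ (-δ) - (k + 1) ^ (-δ) := by
  have hk1 : 0 < k + 1 := by linarith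
  have h1 : (k + 1) ^ (-(δ + 1)) = (k + 1) ^ (-δ) / (k + 1) := by
    rw [neg_add, ← sub_eq_add_neg, Real.rpow_sub_one hk1.ne']
  have h2 : (k + 1) ^ (-δ) * (1 + δ / (k + 1)) ≤ k ^ (-δ) := by
    have h3 : Real.log k - Real.log (k + 1) ≤ -(1 / (k + 1)) := by
      rw [← Real.log_div hk.ne' hk1.ne']
      refine (Real.log_le_sub_one_of_pos (div_pos hk hk1)).trans_eq ?_
      field_simp
      ring
    rw [Real.rpow_def_of_pos hk, Real.rpow_def_of_pos hk1]
    calc _ ≤ Real.exp (Real.log (k + 1) * -δ) * Real.exp (δ / (k + 1)) := by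
          gcongr
          rw [add_comm]; exact Real.add_one_le_exp _
      _ ≤ _ := by
          rw [← Real.exp_add, Real.exp_le_exp, div_eq_mul_one_div]
          nlinarith
  rw [h1]
  calc δ * ((k + 1) ^ (-δ) / (k + 1)) = (k + 1) ^ (-δ) * (1 + δ / (k + 1)) - (k + 1) ^ (-δ) := by
        ring
    _ ≤ _ := by linarith

lemma sum_range_rpow_neg_le {δ : ℝ} (hδ : 0 < δ) (j N : ℕ) :
    ∑ i ∈ Finset.range N, (((j + i : ℕ) : ℝ) + 1) ^ (-(δ + 1)) ≤
      (1 + 1 / δ) * ((j : ℝ) + 1) ^ (-δ) := by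
  have hpos : ∀ k : ℕ, 0 < (k : ℝ) + 1 := fun k => by positivity
  have key : ∀ N : ℕ, ∑ i ∈ Finset.range (N + 1), (((j + i : ℕ) : ℝ) + 1) ^ (-(δ + 1)) ≤
      ((j : ℝ) + 1) ^ (-δ) +
        1 / δ * (((j : ℝ) + 1) ^ (-δ) - (((j + N : ℕ) : ℝ) + 1) ^ (-δ)) := by
    intro N
    induction N with
    | zero =>
      simp only [zero_add, Finset.sum_range_one, add_zero, sub_self, mul_zero]
      exact Real.rpow_le_rpow_of_exponent_le (by simp) (by linarith)
    | succ N ih =>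
      rw [Finset.sum_range_succ]
      have h := rpow_neg_add_one_le hδ (hpos (j + N))
      have h2 : (((j + (N + 1) : ℕ) : ℝ) + 1) ^ (-(δ + 1)) ≤
          1 / δ * ((((j + N : ℕ) : ℝ) + 1) ^ (-δ) - (((j + (N + 1) : ℕ) : ℝ) + 1) ^ (-δ)) := by
        rw [one_div, le_inv_mul_iff₀ hδ]
        simpa [add_assoc] using h
      linarith
  rcases N with _ | N
  · simp only [Finset.range_zero, Finset.sum_empty]
    have := Real.rpow_nonneg (hpos j).le (-δ)
    positivity
  · refine (key N).trans ?_
    have h1 := Real.rpow_nonneg (hpos (j + N)).le (-δ)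
    have h2 : 0 ≤ 1 / δ * (((j + N : ℕ) : ℝ) + 1) ^ (-δ) := mul_nonneg (by positivity) h1
    linarith

section RegularGrowth

variable {p : ℕ → ℝ} {δ : ℝ}

lemma inv_le_of_monotone_rpow_mul (hp : ∀ k, 0 < p k)
    (hmono : Monotone fun k : ℕ => ((k : ℝ) + 1) ^ (-(δ + 1)) * p k) (j i : ℕ) :
    (p (j + i))⁻¹ ≤
      (p j)⁻¹ * ((j : ℝ) + 1) ^ (δ + 1) * (((j + i : ℕ) : ℝ) + 1) ^ (-(δ + 1)) := by
  have hpos : ∀ k : ℕ, 0 < (k : ℝ) + 1 := fun k => by positivity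
  have h := hmono (Nat.le_add_right j i)
  dsimp only at h
  have h1 := Real.rpow_pos_of_pos (hpos (j + i)) (-(δ + 1))
  rw [Real.rpow_neg (hpos j).le, inv_mul_eq_div,
    div_le_iff₀ (Real.rpow_pos_of_pos (hpos j) _)] at h
  rw [inv_le_iff_one_le_mul₀ (hp _), mul_assoc, mul_assoc, inv_mul_eq_div, le_div_iff₀ (hp j)]
  linarith

lemma sum_range_inv_le (hδ : 0 < δ) (hp : ∀ k, 0 < p k)
    (hmono : Monotone fun k : ℕ => ((k : ℝ) + 1) ^ (-(δ + 1)) * p k) (j N : ℕ) :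
    ∑ i ∈ Finset.range N, (p (j + i))⁻¹ ≤ (1 + 1 / δ) * ((j : ℝ) + 1) * (p j)⁻¹ := by
  have hj : 0 < (j : ℝ) + 1 := by positivity
  refine (Finset.sum_le_sum fun i _ => inv_le_of_monotone_rpow_mul hp hmono j i).trans ?_
  rw [← Finset.mul_sum]
  have h0 : 0 ≤ (p j)⁻¹ * ((j : ℝ) + 1) ^ (δ + 1) :=
    mul_nonneg (inv_nonneg.2 (hp j).le) (Real.rpow_nonneg hj.le _)
  refine (mul_le_mul_of_nonneg_left (sum_range_rpow_neg_le hδ j N) h0).trans_eq ?_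
  have h1 : ((j : ℝ) + 1) ^ (δ + 1) * ((j : ℝ) + 1) ^ (-δ) = (j : ℝ) + 1 := by
    rw [← Real.rpow_add hj]; simp
  calc _ = (p j)⁻¹ * (1 + 1 / δ) * (((j : ℝ) + 1) ^ (δ + 1) * ((j : ℝ) + 1) ^ (-δ)) := by ring
    _ = _ := by rw [h1]; ring

lemma summable_inv_of_monotone_rpow_mul (hδ : 0 < δ) (hp : ∀ k, 0 < p k)
    (hmono : Monotone fun k : ℕ => ((k : ℝ) + 1) ^ (-(δ + 1)) * p k) (j : ℕ) :
    Summable fun i => (p (j + i))⁻¹ :=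
  summable_of_sum_range_le (fun _ => inv_nonneg.2 (hp _).le) (sum_range_inv_le hδ hp hmono j)

lemma tsum_inv_le (hδ : 0 < δ) (hp : ∀ k, 0 < p k)
    (hmono : Monotone fun k : ℕ => ((k : ℝ) + 1) ^ (-(δ + 1)) * p k) (j : ℕ) :
    ∑' i, (p (j + i))⁻¹ ≤ (1 + 1 / δ) * ((j : ℝ) + 1) * (p j)⁻¹ :=
  Real.tsum_le_of_sum_range_le (fun _ => inv_nonneg.2 (hp _).le) (sum_range_inv_le hδ hp hmono j)

end RegularGrowth

lemma one_add_mem_slitPlane {x : ℂ} (hx : 0 ≤ x.re) : 1 + x ∈ Complex.slitPlane :=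
  Or.inl (by simp only [Complex.add_re, Complex.one_re]; linarith)

lemma one_le_norm_one_add {x : ℂ} (hx : 0 ≤ x.re) : 1 ≤ ‖1 + x‖ :=
  le_trans (by simpa using hx) (Complex.re_le_norm (1 + x))

lemma norm_le_norm_one_add {x : ℂ} (hx : 0 ≤ x.re) : ‖x‖ ≤ ‖1 + x‖ := by
  rw [← sq_le_sq₀ (norm_nonneg _) (norm_nonneg _), Complex.sq_norm, Complex.sq_norm,
    Complex.normSq_apply, Complex.normSq_apply]
  simp only [Complex.add_re, Complex.one_re, Complex.add_im, Complex.one_im]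
  nlinarith

lemma norm_log_one_add_le_norm {x : ℂ} (hx : 0 ≤ x.re) : ‖Complex.log (1 + x)‖ ≤ ‖x‖ := by
  have hderiv : ∀ y ∈ {y : ℂ | 0 ≤ y.re},
      HasDerivAt (fun y => Complex.log (1 + y)) (1 / (1 + y)) y := fun y hy => by
    simpa using ((hasDerivAt_id y).const_add 1).clog (one_add_mem_slitPlane hy)
  have := (convex_halfSpace_re_ge 0).norm_image_sub_le_of_norm_hasDerivWithin_le
    (f := fun y => Complex.log (1 + y)) (f' := fun y => 1 / (1 + y)) (C := 1)
    (fun y hy => (hderiv y hy).hasDerivWithinAt) (fun y hy => ?_) (x := 0) (y := x) (by simp) hx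
  · simpa using this
  · rw [norm_div, norm_one]
    exact div_le_one_of_le₀ (one_le_norm_one_add hy) (norm_nonneg _)

/-- In the variable `ζ = log w`, this is `w * ∏ k, (1 + (w / n k) ^ (1 / ρ)) ^ (-ρ)`, which decays
at infinity as fast as the sequence with quotients `n` allows. -/
def flatKernel (n : ℕ → ℝ) (ρ : ℝ) (ζ : ℂ) : ℂ :=
  Complex.exp (ζ - ρ * ∑' k, Complex.log (1 + Complex.exp ((ζ - (Real.log (n k) : ℂ)) / ρ)))

section FlatKernel

variable {n : ℕ → ℝ} {ρ γ : ℝ}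

lemma norm_flatFactor (hn : ∀ k, 0 < n k) (k : ℕ) (ζ : ℂ) :
    ‖Complex.exp ((ζ - (Real.log (n k) : ℂ)) / ρ)‖ =
      Real.exp (ζ.re / ρ) * (n k ^ (1 / ρ))⁻¹ := by
  rw [Complex.norm_exp, Real.rpow_def_of_pos (hn k), ← Real.exp_neg, ← Real.exp_add]
  congr 1
  simp only [Complex.div_ofReal_re, Complex.sub_re, Complex.ofReal_re]
  ring

lemma flatFactor_re_nonneg (hρ : 0 < ρ) (k : ℕ) {ζ : ℂ} (hζ : ζ ∈ Strip (ρ * Real.pi / 2)) :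
    0 ≤ (Complex.exp ((ζ - (Real.log (n k) : ℂ)) / ρ)).re := by
  rw [Complex.exp_re]
  refine mul_nonneg (Real.exp_pos _).le (Real.cos_nonneg_of_mem_Icc ?_)
  have h : |ζ.im| < ρ * Real.pi / 2 := hζ
  simp only [Complex.div_ofReal_im, Complex.sub_im, Complex.ofReal_im, sub_zero]
  rw [Set.mem_Icc, ← abs_le, abs_div, abs_of_pos hρ, div_le_iff₀ hρ]
  linarith

lemma monotone_rpow_one_div (hn : ∀ k, 0 < n k)
    (hmono : Monotone fun k : ℕ => ((k : ℝ) + 1) ^ (-γ) * n k) (hρ : 0 < ρ) :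
    Monotone fun k : ℕ => ((k : ℝ) + 1) ^ (-((γ / ρ - 1) + 1)) * n k ^ (1 / ρ) := by
  have heq : (fun k : ℕ => ((k : ℝ) + 1) ^ (-((γ / ρ - 1) + 1)) * n k ^ (1 / ρ)) =
      fun k : ℕ => (((k : ℝ) + 1) ^ (-γ) * n k) ^ (1 / ρ) := by
    funext k
    have hk : 0 < (k : ℝ) + 1 := by positivity
    rw [Real.mul_rpow (Real.rpow_nonneg hk.le _) (hn k).le, ← Real.rpow_mul hk.le]
    congr 2
    ring
  rw [heq]
  intro i j hij
  have hi : 0 < (i : ℝ) + 1 := by positivity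
  exact Real.rpow_le_rpow (mul_nonneg (Real.rpow_nonneg hi.le _) (hn i).le) (hmono hij)
    (by positivity)

lemma summable_inv_rpow (hn : ∀ k, 0 < n k)
    (hmono : Monotone fun k : ℕ => ((k : ℝ) + 1) ^ (-γ) * n k) (hρ : 0 < ρ) (hργ : ρ < γ) :
    Summable fun k => (n k ^ (1 / ρ))⁻¹ := by
  have hδ : 0 < γ / ρ - 1 := by rw [sub_pos, one_lt_div hρ]; exact hργ
  simpa using summable_inv_of_monotone_rpow_mul hδ (fun k => Real.rpow_pos_of_pos (hn k) _)
    (monotone_rpow_one_div hn hmono hρ) 0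

lemma norm_flatSummand_le (hn : ∀ k, 0 < n k) (hρ : 0 < ρ) (k : ℕ) {ζ : ℂ}
    (hζ : ζ ∈ Strip (ρ * Real.pi / 2)) :
    ‖Complex.log (1 + Complex.exp ((ζ - (Real.log (n k) : ℂ)) / ρ))‖ ≤
      Real.exp (ζ.re / ρ) * (n k ^ (1 / ρ))⁻¹ :=
  (norm_log_one_add_le_norm (flatFactor_re_nonneg hρ k hζ)).trans_eq (norm_flatFactor hn k ζ)

lemma summable_flatSummand (hn : ∀ k, 0 < n k)
    (hmono : Monotone fun k : ℕ => ((k : ℝ) + 1) ^ (-γ) * n k) (hρ : 0 < ρ) (hργ : ρ < γ) {ζ : ℂ}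
    (hζ : ζ ∈ Strip (ρ * Real.pi / 2)) :
    Summable fun k => Complex.log (1 + Complex.exp ((ζ - (Real.log (n k) : ℂ)) / ρ)) :=
  Summable.of_norm_bounded ((summable_inv_rpow hn hmono hρ hργ).mul_left _)
    fun k => norm_flatSummand_le hn hρ k hζ

lemma differentiableOn_flatKernel (hn : ∀ k, 0 < n k)
    (hmono : Monotone fun k : ℕ => ((k : ℝ) + 1) ^ (-γ) * n k) (hρ : 0 < ρ) (hργ : ρ < γ) :
    DifferentiableOn ℂ (flatKernel n ρ) (Strip (ρ * Real.pi / 2)) := by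
  have hsum : DifferentiableOn ℂ
      (fun ζ => ∑' k, Complex.log (1 + Complex.exp ((ζ - (Real.log (n k) : ℂ)) / ρ)))
      (Strip (ρ * Real.pi / 2)) := by
    intro ζ₀ hζ₀
    set U : Set ℂ := Strip (ρ * Real.pi / 2) ∩ {ζ | ζ.re < ζ₀.re + 1}
    have hU : IsOpen U := (isOpen_strip _).inter (isOpen_lt Complex.continuous_re continuous_const)
    have hdU : DifferentiableOn ℂ
        (fun ζ => ∑' k, Complex.log (1 + Complex.exp ((ζ - (Real.log (n k) : ℂ)) / ρ))) U := by
      refine Complex.differentiableOn_tsum_of_summable_norm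
        ((summable_inv_rpow hn hmono hρ hργ).mul_left (Real.exp ((ζ₀.re + 1) / ρ)))
        (fun k => ?_) hU fun k ζ hζ => ?_
      · intro ζ hζ
        have hd : DifferentiableAt ℂ
            (fun ζ : ℂ => 1 + Complex.exp ((ζ - (Real.log (n k) : ℂ)) / ρ)) ζ := by fun_prop
        exact (hd.clog (one_add_mem_slitPlane
          (flatFactor_re_nonneg hρ k hζ.1))).differentiableWithinAt
      · refine (norm_flatSummand_le hn hρ k hζ.1).trans ?_
        have := Real.rpow_pos_of_pos (hn k) (1 / ρ)
        have h2 : ζ.re < ζ₀.re + 1 := hζ.2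
        gcongr
    exact (hdU.differentiableAt (hU.mem_nhds ⟨hζ₀, by simp⟩)).differentiableWithinAt
  exact (differentiableOn_id.sub (hsum.const_mul (ρ : ℂ))).cexp

lemma norm_flatKernel_mul_exp_le (hn : ∀ k, 0 < n k)
    (hmono : Monotone fun k : ℕ => ((k : ℝ) + 1) ^ (-γ) * n k) (hρ : 0 < ρ) (hργ : ρ < γ) (m : ℕ)
    {ζ : ℂ} (hζ : ζ ∈ Strip (ρ * Real.pi / 2)) :
    ‖flatKernel n ρ ζ‖ * Real.exp (m * ζ.re) ≤
      Real.exp ζ.re * ∏ k ∈ Finset.range m, n k := by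
  have hs := summable_flatSummand hn hmono hρ hργ hζ
  have hsre := (Complex.hasSum_re hs.hasSum).summable
  have hN : ∏ k ∈ Finset.range m, n k = Real.exp (∑ k ∈ Finset.range m, Real.log (n k)) := by
    rw [Real.exp_sum]; exact Finset.prod_congr rfl fun k _ => (Real.exp_log (hn k)).symm
  rw [flatKernel, Complex.norm_exp, hN, ← Real.exp_add, ← Real.exp_add]
  refine Real.exp_le_exp.2 ?_
  rw [Complex.sub_re, Complex.re_ofReal_mul, Complex.re_tsum hs]
  have h1 : ∑ k ∈ Finset.range m, (ζ.re - Real.log (n k)) / ρ ≤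
      ∑' k, (Complex.log (1 + Complex.exp ((ζ - (Real.log (n k) : ℂ)) / ρ))).re := by
    refine le_trans (Finset.sum_le_sum fun k _ => ?_) (hsre.sum_le_tsum _ fun k _ => ?_)
    · rw [Complex.log_re]
      refine le_trans (le_of_eq ?_) (Real.log_le_log (norm_pos_iff.2 (Complex.exp_ne_zero _))
        (norm_le_norm_one_add (flatFactor_re_nonneg hρ k hζ)))
      rw [Complex.norm_exp, Real.log_exp]
      simp only [Complex.div_ofReal_re, Complex.sub_re, Complex.ofReal_re]
    · rw [Complex.log_re]
      exact Real.log_nonneg (one_le_norm_one_add (flatFactor_re_nonneg hρ k hζ))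
  rw [← Finset.sum_div, div_le_iff₀ hρ, Finset.sum_sub_distrib, Finset.sum_const,
    Finset.card_range, nsmul_eq_mul] at h1
  linarith

lemma norm_flatKernel_mul_exp_le_exp_neg_abs (hn : ∀ k, 0 < n k)
    (hmono : Monotone fun k : ℕ => ((k : ℝ) + 1) ^ (-γ) * n k) (hρ : 0 < ρ) (hργ : ρ < γ)
    {C : ℝ} (hC : 1 ≤ C) (hnC : ∀ k, n k ≤ C ^ (k + 1)) (m : ℕ) {ζ : ℂ}
    (hζ : ζ ∈ Strip (ρ * Real.pi / 2)) :
    ‖flatKernel n ρ ζ‖ * Real.exp (m * ζ.re) ≤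
      C ^ (2 * m + 3) * (∏ k ∈ Finset.range m, n k) * Real.exp (-|ζ.re|) := by
  have hN : 0 ≤ ∏ k ∈ Finset.range m, n k := Finset.prod_nonneg fun k _ => (hn k).le
  rcases le_total ζ.re 0 with h | h
  · rw [abs_of_nonpos h, neg_neg]
    refine (norm_flatKernel_mul_exp_le hn hmono hρ hργ m hζ).trans ?_
    rw [mul_comm (Real.exp _), mul_assoc]
    exact le_mul_of_one_le_left (by positivity) (one_le_pow₀ hC)
  · rw [abs_of_nonneg h]
    have h1 := norm_flatKernel_mul_exp_le hn hmono hρ hργ (m + 2) hζ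
    rw [Finset.prod_range_succ, Finset.prod_range_succ] at h1
    have h2 : Real.exp (((m + 2 : ℕ) : ℝ) * ζ.re) =
        Real.exp (m * ζ.re) * Real.exp ζ.re * Real.exp ζ.re := by
      rw [← Real.exp_add, ← Real.exp_add]; congr 1; push_cast; ring
    rw [h2, ← mul_assoc, ← mul_assoc, mul_comm (Real.exp ζ.re) (_ * _ * _)] at h1
    have h3 := le_of_mul_le_mul_right h1 (Real.exp_pos _)
    rw [Real.exp_neg, ← div_eq_mul_inv, le_div_iff₀ (Real.exp_pos _)]
    refine h3.trans ?_
    calc (∏ k ∈ Finset.range m, n k) * n m * n (m + 1)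
        ≤ (∏ k ∈ Finset.range m, n k) * C ^ (m + 1) * C ^ (m + 1 + 1) := by
          gcongr
          · exact (hn _).le
          · exact hnC m
          · exact hnC (m + 1)
      _ = _ := by ring

end FlatKernel

section Moments

variable {n : ℕ → ℝ} {ρ γ : ℝ}

/-- The moments of `flatKernel`, in logarithmic coordinates. -/
def flatMoment (n : ℕ → ℝ) (ρ : ℝ) (j : ℕ) : ℂ :=
  ∫ x : ℝ, flatKernel n ρ x * Complex.exp (j * x)

lemma flatKernel_ofReal (x : ℝ) : flatKernel n ρ x = (Real.exp
    (x - ρ * ∑' k, Real.log (1 + Real.exp ((x - Real.log (n k)) / ρ))) : ℂ) := by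
  have h : ∀ k, Complex.log (1 + Complex.exp (((x : ℂ) - (Real.log (n k) : ℂ)) / ρ)) =
      (Real.log (1 + Real.exp ((x - Real.log (n k)) / ρ)) : ℂ) := fun k => by
    rw [Complex.ofReal_log (x := 1 + Real.exp ((x - Real.log (n k)) / ρ)) (by positivity)]
    simp only [Complex.ofReal_add, Complex.ofReal_one, Complex.ofReal_exp, Complex.ofReal_div,
      Complex.ofReal_sub]
  simp only [flatKernel, h, Complex.ofReal_exp, Complex.ofReal_sub, Complex.ofReal_mul,
    Complex.ofReal_tsum]

lemma monotone_quotients (hn : ∀ k, 0 < n k)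
    (hmono : Monotone fun k : ℕ => ((k : ℝ) + 1) ^ (-γ) * n k) (hγ : 0 ≤ γ) : Monotone n := by
  intro i j hij
  have hi : 0 < (i : ℝ) + 1 := by positivity
  have hij' : (i : ℝ) ≤ j := by exact_mod_cast hij
  have h1 := Real.rpow_pos_of_pos hi (-γ)
  refine le_of_mul_le_mul_left ((hmono hij).trans ?_) h1
  exact mul_le_mul_of_nonneg_right (Real.rpow_le_rpow_of_nonpos hi (by linarith) (by linarith))
    (hn j).le

/-- The decay of `flatKernel` is optimal on the real axis. -/
lemma le_flatExponent (hn : ∀ k, 0 < n k)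
    (hmono : Monotone fun k : ℕ => ((k : ℝ) + 1) ^ (-γ) * n k) (hρ : 0 < ρ) (hργ : ρ < γ) :
    ∃ D : ℝ, 0 ≤ D ∧ ∀ (j : ℕ) (x : ℝ), Real.log (n j) ≤ x → x ≤ Real.log (n j) + 1 →
      ρ * ∑' k, Real.log (1 + Real.exp ((x - Real.log (n k)) / ρ)) ≤
        j * x - Real.log (∏ k ∈ Finset.range j, n k) + D * (j + 1) := by
  have hδ : 0 < γ / ρ - 1 := by rw [sub_pos, one_lt_div hρ]; exact hργ
  have hp : ∀ k, 0 < n k ^ (1 / ρ) := fun k => Real.rpow_pos_of_pos (hn k) _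
  have hnmono := monotone_quotients hn hmono (hρ.trans hργ).le
  have hfac : ∀ (x : ℝ) (k : ℕ), Real.exp ((x - Real.log (n k)) / ρ) =
      Real.exp (x / ρ) * (n k ^ (1 / ρ))⁻¹ := fun x k => by
    rw [Real.rpow_def_of_pos (hn k), ← Real.exp_neg, ← Real.exp_add]
    congr 1; ring
  have hle : ∀ (x : ℝ) (k : ℕ), Real.log (1 + Real.exp ((x - Real.log (n k)) / ρ)) ≤
      Real.exp (x / ρ) * (n k ^ (1 / ρ))⁻¹ := fun x k => by
    rw [← hfac]
    refine (Real.log_le_sub_one_of_pos (by positivity)).trans_eq (by ring)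
  have h0 : ∀ (x : ℝ) (k : ℕ), 0 ≤ Real.log (1 + Real.exp ((x - Real.log (n k)) / ρ)) :=
    fun x k => Real.log_nonneg (by linarith [Real.exp_pos ((x - Real.log (n k)) / ρ)])
  have hsum : ∀ x : ℝ, Summable fun k => Real.log (1 + Real.exp ((x - Real.log (n k)) / ρ)) :=
    fun x => Summable.of_nonneg_of_le (h0 x) (hle x)
      ((summable_inv_rpow hn hmono hρ hργ).mul_left _)
  refine ⟨ρ * (Real.log 2 + Real.exp (1 / ρ) * (1 + 1 / (γ / ρ - 1))), ?_, fun j x hx1 hx2 => ?_⟩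
  · have := Real.log_nonneg (one_le_two : (1 : ℝ) ≤ 2)
    positivity
  have hhead : ∑ k ∈ Finset.range j, Real.log (1 + Real.exp ((x - Real.log (n k)) / ρ)) ≤
      j * Real.log 2 + (j * x - Real.log (∏ k ∈ Finset.range j, n k)) / ρ := by
    have heq : j * Real.log 2 + (j * x - Real.log (∏ k ∈ Finset.range j, n k)) / ρ =
        ∑ k ∈ Finset.range j, (Real.log 2 + (x - Real.log (n k)) / ρ) := by
      rw [Real.log_prod fun k _ => (hn k).ne', Finset.sum_add_distrib, ← Finset.sum_div,
        Finset.sum_sub_distrib]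
      simp
    rw [heq]
    refine Finset.sum_le_sum fun k hk => ?_
    have hkj : Real.log (n k) ≤ Real.log (n j) :=
      Real.log_le_log (hn k) (hnmono (Finset.mem_range.1 hk).le)
    have h1 : 1 ≤ Real.exp ((x - Real.log (n k)) / ρ) :=
      Real.one_le_exp (div_nonneg (by linarith) hρ.le)
    calc _ ≤ Real.log (2 * Real.exp ((x - Real.log (n k)) / ρ)) :=
          Real.log_le_log (by positivity) (by linarith)
      _ = _ := by rw [Real.log_mul two_ne_zero (Real.exp_pos _).ne', Real.log_exp]
  have htail : ∑' k, Real.log (1 + Real.exp ((x - Real.log (n (k + j))) / ρ)) ≤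
      Real.exp (1 / ρ) * (1 + 1 / (γ / ρ - 1)) * (j + 1) := by
    have hs := summable_inv_of_monotone_rpow_mul hδ hp (monotone_rpow_one_div hn hmono hρ) j
    have ht := tsum_inv_le hδ hp (monotone_rpow_one_div hn hmono hρ) j
    have h1 : ∑' k, Real.log (1 + Real.exp ((x - Real.log (n (k + j))) / ρ)) ≤
        ∑' k, Real.exp (x / ρ) * (n (j + k) ^ (1 / ρ))⁻¹ := by
      refine ((summable_nat_add_iff j).2 (hsum x)).tsum_le_tsum (fun k => ?_) (hs.mul_left _)
      rw [add_comm k j]; exact hle x (j + k)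
    rw [tsum_mul_left] at h1
    have h2 : Real.exp (x / ρ) * (n j ^ (1 / ρ))⁻¹ ≤ Real.exp (1 / ρ) := by
      rw [← hfac]; gcongr; linarith
    calc _ ≤ Real.exp (x / ρ) * ((1 + 1 / (γ / ρ - 1)) * ((j : ℝ) + 1) * (n j ^ (1 / ρ))⁻¹) :=
          h1.trans (mul_le_mul_of_nonneg_left ht (Real.exp_pos _).le)
      _ = (Real.exp (x / ρ) * (n j ^ (1 / ρ))⁻¹) * ((1 + 1 / (γ / ρ - 1)) * (j + 1)) := by ring
      _ ≤ Real.exp (1 / ρ) * ((1 + 1 / (γ / ρ - 1)) * (j + 1)) := by gcongr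
      _ = _ := by ring
  rw [← (hsum x).sum_add_tsum_nat_add j]
  have hl2 := Real.log_nonneg (one_le_two : (1 : ℝ) ≤ 2)
  calc _ ≤ ρ * ((j * Real.log 2 + (j * x - Real.log (∏ k ∈ Finset.range j, n k)) / ρ) +
        Real.exp (1 / ρ) * (1 + 1 / (γ / ρ - 1)) * (j + 1)) := by gcongr
    _ = j * x - Real.log (∏ k ∈ Finset.range j, n k) + ρ * (j * Real.log 2 +
        Real.exp (1 / ρ) * (1 + 1 / (γ / ρ - 1)) * (j + 1)) := by field_simp; ring
    _ ≤ _ := by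
      have : ρ * (j * Real.log 2) ≤ ρ * (Real.log 2 * (j + 1)) :=
        mul_le_mul_of_nonneg_left (by linarith) hρ.le
      linarith

lemma prod_le_flatMoment (hn : ∀ k, 0 < n k)
    (hmono : Monotone fun k : ℕ => ((k : ℝ) + 1) ^ (-γ) * n k) (hρ : 0 < ρ) (hργ : ρ < γ)
    {C : ℝ} (hC : 1 ≤ C) (hnC : ∀ k, n k ≤ C ^ (k + 1)) :
    ∃ c B : ℝ, 0 < c ∧ 1 ≤ B ∧
      ∀ j, ∏ k ∈ Finset.range j, n k ≤ c * B ^ j * ‖flatMoment n ρ j‖ := by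
  obtain ⟨D, hD, hexp⟩ := le_flatExponent hn hmono hρ hργ
  refine ⟨Real.exp D / n 0, Real.exp D, div_pos (Real.exp_pos _) (hn 0), Real.one_le_exp hD,
    fun j => ?_⟩
  have hNpos : 0 < ∏ k ∈ Finset.range j, n k := Finset.prod_pos fun k _ => hn k
  have hstrip : (0 : ℂ) ∈ Strip (ρ * Real.pi / 2) := by
    simp only [Strip, Set.mem_ofPred_eq, Complex.zero_im, abs_zero]
    have := Real.pi_pos
    positivity
  set v : ℝ → ℝ := fun x =>
    Real.exp (x - ρ * ∑' k, Real.log (1 + Real.exp ((x - Real.log (n k)) / ρ))) *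
      Real.exp (j * x) with hv
  have hvC : ∀ x : ℝ, flatKernel n ρ x * Complex.exp (j * x) = (v x : ℂ) := fun x => by
    rw [flatKernel_ofReal, hv]; push_cast; rfl
  have hv0 : ∀ x, 0 ≤ v x := fun x => by positivity
  have hdiff : DifferentiableOn ℂ (fun ζ : ℂ => flatKernel n ρ ζ * Complex.exp (j * ζ))
      (Strip (ρ * Real.pi / 2)) :=
    (differentiableOn_flatKernel hn hmono hρ hργ).mul (by fun_prop)
  have hbound : ∀ ζ ∈ Strip (ρ * Real.pi / 2), ‖flatKernel n ρ ζ * Complex.exp (j * ζ)‖ ≤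
      C ^ (2 * j + 3) * (∏ k ∈ Finset.range j, n k) * Real.exp (-|ζ.re|) := fun ζ hζ => by
    rw [norm_mul, Complex.norm_exp]
    simpa using norm_flatKernel_mul_exp_le_exp_neg_abs hn hmono hρ hργ hC hnC j hζ
  have hint : Integrable v := by
    have := integrable_convolution hdiff hbound (g := fun _ => 1) (B := 1) measurable_const
      (by simp) hstrip
    simp only [sub_zero, mul_one, hvC] at this
    exact_mod_cast this.re
  have hmom : ‖flatMoment n ρ j‖ = ∫ x, v x := by
    simp only [flatMoment, hvC]
    rw [integral_complex_ofReal, Complex.norm_real, Real.norm_eq_abs, abs_of_nonneg (integral_nonneg hv0)]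
  have hlow : n 0 * (∏ k ∈ Finset.range j, n k) * Real.exp (-(D * (j + 1))) ≤ ∫ x, v x := by
    refine le_trans ?_ (setIntegral_le_integral (s := Set.Icc (Real.log (n j)) (Real.log (n j) + 1))
      hint (ae_of_all _ hv0))
    have h := setIntegral_ge_of_const_le_real (μ := volume)
      (s := Set.Icc (Real.log (n j)) (Real.log (n j) + 1)) (f := v)
      (c := n 0 * (∏ k ∈ Finset.range j, n k) * Real.exp (-(D * (j + 1)))) measurableSet_Icc
      (by simp) (fun x hx => ?_) hint.integrableOn
    · simpa using h
    · have heq : n 0 * (∏ k ∈ Finset.range j, n k) * Real.exp (-(D * (j + 1))) = Real.exp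
          (Real.log (n 0) + Real.log (∏ k ∈ Finset.range j, n k) + -(D * (j + 1))) := by
        rw [Real.exp_add, Real.exp_add, Real.exp_log (hn 0), Real.exp_log hNpos]
      rw [heq, hv]
      dsimp only
      rw [← Real.exp_add, Real.exp_le_exp]
      have h1 := hexp j x hx.1 hx.2
      have h2 : Real.log (n 0) ≤ Real.log (n j) :=
        Real.log_le_log (hn 0) (monotone_quotients hn hmono (hρ.trans hργ).le (Nat.zero_le j))
      have h3 := hx.1
      linarith
  rw [hmom]
  have hpow : Real.exp D ^ j = Real.exp (D * j) := by rw [mul_comm, Real.exp_nat_mul]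
  calc ∏ k ∈ Finset.range j, n k
      = Real.exp D / n 0 * Real.exp D ^ j *
        (n 0 * (∏ k ∈ Finset.range j, n k) * Real.exp (-(D * (j + 1)))) := by
        rw [hpow, show -(D * ((j : ℝ) + 1)) = -D + -(D * j) by ring, Real.exp_add, Real.exp_neg,
          Real.exp_neg]
        have := (hn 0).ne'
        field_simp
    _ ≤ _ := by
        have := hn 0
        gcongr

end Moments

section PowerSeries

variable {b : ℕ → ℂ} {C B y : ℝ}

lemma sum_range_half_pow_le (m : ℕ) : ∑ j ∈ Finset.range m, (1 / 2 : ℝ) ^ j ≤ 2 :=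
  (summable_geometric_two.sum_le_tsum _ fun _ _ => by positivity).trans_eq tsum_geometric_two

lemma norm_sum_range_mul_pow_le (hb : ∀ j, ‖b j‖ ≤ C * B ^ j) (hC : 0 ≤ C)
    (hy0 : 0 ≤ y) (hy : 1 ≤ 2 * B * y) (m : ℕ) :
    ‖∑ j ∈ Finset.range m, b j * (y : ℂ) ^ j‖ ≤ 2 * C * (2 * B * y) ^ m := by
  refine (norm_sum_le _ _).trans ?_
  calc ∑ j ∈ Finset.range m, ‖b j * (y : ℂ) ^ j‖
      ≤ ∑ j ∈ Finset.range m, C * (2 * B * y) ^ m * (1 / 2) ^ j := by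
        refine Finset.sum_le_sum fun j hj => ?_
        rw [norm_mul, norm_pow, Complex.norm_real, Real.norm_of_nonneg hy0]
        calc ‖b j‖ * y ^ j ≤ C * B ^ j * y ^ j := by gcongr; exact hb j
          _ = C * (2 * B * y) ^ j * (1 / 2) ^ j := by
            rw [mul_assoc, mul_assoc, ← mul_pow, ← mul_pow]; congr 2; ring
          _ ≤ _ := by
            have := pow_le_pow_right₀ hy (Finset.mem_range.1 hj).le
            gcongr
    _ = C * (2 * B * y) ^ m * ∑ j ∈ Finset.range m, (1 / 2 : ℝ) ^ j := by rw [Finset.mul_sum]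
    _ ≤ C * (2 * B * y) ^ m * 2 := by
        have := sum_range_half_pow_le m
        gcongr
    _ = _ := by ring

lemma norm_mul_pow_le_half_pow (hb : ∀ j, ‖b j‖ ≤ C * B ^ j) (hB : 0 ≤ B) (hC : 0 ≤ C)
    (hy0 : 0 ≤ y) (hy : 2 * B * y ≤ 1) (m i : ℕ) :
    ‖b (i + m) * (y : ℂ) ^ (i + m)‖ ≤ C * (2 * B * y) ^ m * (1 / 2) ^ i := by
  rw [norm_mul, norm_pow, Complex.norm_real, Real.norm_of_nonneg hy0]
  calc ‖b (i + m)‖ * y ^ (i + m) ≤ C * B ^ (i + m) * y ^ (i + m) := by gcongr; exact hb _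
    _ = C * (B * y) ^ m * (B * y) ^ i := by rw [mul_assoc, ← mul_pow]; ring
    _ ≤ _ := by
      have : 0 ≤ B * y := mul_nonneg hB hy0
      gcongr <;> linarith

lemma summable_mul_pow (hb : ∀ j, ‖b j‖ ≤ C * B ^ j) (hB : 0 ≤ B) (hC : 0 ≤ C)
    (hy0 : 0 ≤ y) (hy : 2 * B * y ≤ 1) : Summable fun j => b j * (y : ℂ) ^ j :=
  Summable.of_norm_bounded (summable_geometric_two.mul_left (C * (2 * B * y) ^ 0))
    fun j => norm_mul_pow_le_half_pow hb hB hC hy0 hy 0 j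

lemma norm_tsum_mul_pow_sub_le (hb : ∀ j, ‖b j‖ ≤ C * B ^ j) (hB : 0 ≤ B) (hC : 0 ≤ C)
    (hy0 : 0 ≤ y) (hy : 2 * B * y ≤ 1) (m : ℕ) :
    ‖∑' j, b j * (y : ℂ) ^ j - ∑ j ∈ Finset.range m, b j * (y : ℂ) ^ j‖ ≤
      2 * C * (2 * B * y) ^ m := by
  rw [← (summable_mul_pow hb hB hC hy0 hy).sum_add_tsum_nat_add m, add_sub_cancel_left]
  refine (tsum_of_norm_bounded (summable_geometric_two.mul_left (C * (2 * B * y) ^ m)).hasSum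
    fun i => norm_mul_pow_le_half_pow hb hB hC hy0 hy m i).trans_eq ?_
  rw [tsum_mul_left, tsum_geometric_two]
  ring

/-- A sequence of at most geometric growth has a bounded truncated Borel sum. -/
lemma exists_truncated_powerSeries (hb : ∀ j, ‖b j‖ ≤ C * B ^ j) (hB : 0 ≤ B) (hC : 0 ≤ C) :
    ∃ g : ℝ → ℂ, Measurable g ∧ ∀ (m : ℕ) (x : ℝ),
      ‖g x - ∑ j ∈ Finset.range m, b j * Complex.exp (j * x)‖ ≤
        2 * C * (2 * B) ^ m * Real.exp (m * x) := by
  set S : Set ℝ := {x | 2 * B * Real.exp x ≤ 1} with hS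
  have hSm : MeasurableSet S := measurableSet_le (by fun_prop) measurable_const
  have hexp : ∀ (j : ℕ) (x : ℝ), Complex.exp (j * x) = ((Real.exp x : ℝ) : ℂ) ^ j := fun j x => by
    rw [Complex.ofReal_exp, ← Complex.exp_nat_mul]
  have hexpr : ∀ (j : ℕ) (x : ℝ), Real.exp (j * x) = Real.exp x ^ j := fun j x =>
    Real.exp_nat_mul x j
  refine ⟨S.indicator fun x => ∑' j, b j * ((Real.exp x : ℝ) : ℂ) ^ j, ?_, fun m x => ?_⟩
  · refine measurable_of_tendsto_metrizable (f := fun (N : ℕ) => S.indicator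
      fun x => ∑ j ∈ Finset.range N, b j * ((Real.exp x : ℝ) : ℂ) ^ j)
      (fun N => Measurable.indicator (by fun_prop) hSm) (tendsto_pi_nhds.2 fun x => ?_)
    by_cases hx : x ∈ S
    · simp only [Set.indicator_of_mem hx]
      exact (summable_mul_pow hb hB hC (Real.exp_pos x).le hx).hasSum.tendsto_sum_nat
    · simp only [Set.indicator_of_notMem hx]
      exact tendsto_const_nhds
  · simp only [hexp, hexpr]
    rw [mul_assoc _ _ (Real.exp x ^ m), ← mul_pow]
    by_cases hx : x ∈ S
    · rw [Set.indicator_of_mem hx]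
      exact norm_tsum_mul_pow_sub_le hb hB hC (Real.exp_pos x).le hx m
    · rw [Set.indicator_of_notMem hx, zero_sub, norm_neg]
      exact norm_sum_range_mul_pow_le hb hC (Real.exp_pos x).le (le_of_not_ge hx) m

end PowerSeries

/-- The truncated Laplace transform realizes every asymptotic expansion of Roumieu type,
in logarithmic coordinates. -/
lemma exists_asymptotic_in_strip {n : ℕ → ℝ} {ρ γ : ℝ} (hn : ∀ k, 0 < n k)
    (hmono : Monotone fun k : ℕ => ((k : ℝ) + 1) ^ (-γ) * n k) (hρ : 0 < ρ) (hργ : ρ < γ)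
    (hnC : ∃ C, 1 ≤ C ∧ ∀ k, n k ≤ C ^ (k + 1)) {a : ℕ → ℂ} {C B : ℝ} (hC : 0 ≤ C) (hB : 1 ≤ B)
    (ha : ∀ j, ‖a j‖ ≤ C * B ^ j * ∏ k ∈ Finset.range j, n k) :
    ∃ F : ℂ → ℂ, DifferentiableOn ℂ F (Strip (ρ * Real.pi / 2)) ∧ ∃ E K : ℝ, 0 ≤ E ∧ 0 < K ∧
      ∀ (m : ℕ), ∀ ζ ∈ Strip (ρ * Real.pi / 2),
        ‖F ζ - ∑ j ∈ Finset.range m, a j * Complex.exp (j * ζ)‖ ≤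
          E * K ^ m * (∏ k ∈ Finset.range m, n k) * Real.exp (m * ζ.re) := by
  obtain ⟨D, hD, hnD⟩ := hnC
  obtain ⟨c, B', hc, hB', hmoment⟩ := prod_le_flatMoment hn hmono hρ hργ hD hnD
  have hNpos : ∀ j, 0 < ∏ k ∈ Finset.range j, n k := fun j => Finset.prod_pos fun k _ => hn k
  have hμ : ∀ j, flatMoment n ρ j ≠ 0 := fun j h => by
    have := hmoment j
    rw [h, norm_zero, mul_zero] at this
    exact (hNpos j).not_ge this
  have hb : ∀ j, ‖a j / flatMoment n ρ j‖ ≤ (C * c) * (B * B') ^ j := fun j => by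
    rw [norm_div, div_le_iff₀ (norm_pos_iff.2 (hμ j))]
    calc ‖a j‖ ≤ C * B ^ j * (c * B' ^ j * ‖flatMoment n ρ j‖) :=
          (ha j).trans (mul_le_mul_of_nonneg_left (hmoment j) (by positivity))
      _ = _ := by rw [mul_pow]; ring
  have hBB : 0 < B * B' := by positivity
  have hCc : 0 ≤ C * c := by positivity
  obtain ⟨g, hgm, hg⟩ := exists_truncated_powerSeries hb hBB.le hCc
  have hg0 : ∀ x, ‖g x‖ ≤ 2 * (C * c) := fun x => by simpa using hg 0 x
  set k := flatKernel n ρ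
  have hkd : DifferentiableOn ℂ k (Strip (ρ * Real.pi / 2)) :=
    differentiableOn_flatKernel hn hmono hρ hργ
  have hkb : ∀ (j : ℕ), ∀ ζ ∈ Strip (ρ * Real.pi / 2), ‖k ζ * Complex.exp (j * ζ)‖ ≤
      D ^ (2 * j + 3) * (∏ k ∈ Finset.range j, n k) * Real.exp (-|ζ.re|) := fun j ζ hζ => by
    rw [norm_mul, Complex.norm_exp]
    simpa using norm_flatKernel_mul_exp_le_exp_neg_abs hn hmono hρ hργ hD hnD j hζ
  have hkb0 : ∀ ζ ∈ Strip (ρ * Real.pi / 2), ‖k ζ‖ ≤ D ^ 3 * Real.exp (-|ζ.re|) := fun ζ hζ => by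
    simpa using hkb 0 ζ hζ
  have hkdj : ∀ j : ℕ, DifferentiableOn ℂ (fun ζ => k ζ * Complex.exp (j * ζ))
      (Strip (ρ * Real.pi / 2)) := fun j => hkd.mul (by fun_prop)
  have hshift : ∀ (j : ℕ) (ζ : ℂ) (x : ℝ), k (x - ζ) * Complex.exp (j * (x - ζ)) *
      Complex.exp (j * ζ) = k (x - ζ) * Complex.exp (j * x) := fun j ζ x => by
    rw [mul_assoc, ← Complex.exp_add]; congr 2; ring
  have hterm : ∀ j : ℕ, ∀ ζ ∈ Strip (ρ * Real.pi / 2),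
      Integrable (fun x : ℝ => k (x - ζ) * (a j / flatMoment n ρ j * Complex.exp (j * x))) ∧
      ∫ x : ℝ, k (x - ζ) * (a j / flatMoment n ρ j * Complex.exp (j * x)) =
        a j * Complex.exp (j * ζ) := fun j ζ hζ => by
    have heq : (fun x : ℝ => k (x - ζ) * (a j / flatMoment n ρ j * Complex.exp (j * x))) =
        fun x : ℝ => (k (x - ζ) * Complex.exp (j * (x - ζ))) *
          (a j / flatMoment n ρ j * Complex.exp (j * ζ)) := by
      funext x
      rw [mul_left_comm, ← hshift]; ring
    have hi := integrable_convolution (hkdj j) (hkb j) (g := fun _ => 1) (B := 1)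
      measurable_const (by simp) hζ
    simp only [mul_one] at hi
    rw [heq]
    refine ⟨hi.mul_const _, ?_⟩
    have hc := integral_sub_eq_integral (hkdj j) (hkb j) hζ
    rw [integral_mul_const, hc]
    change flatMoment n ρ j * _ = _
    have := hμ j
    field_simp
  refine ⟨fun ζ => ∫ x : ℝ, k (x - ζ) * g x, differentiableOn_convolution hkd hkb0 hgm hg0,
    2 * (C * c) * D ^ 3 * ∫ x : ℝ, Real.exp (-|x|), 2 * (B * B') * D ^ 2, ?_, by positivity,
    fun m ζ hζ => ?_⟩
  · have : 0 ≤ ∫ x : ℝ, Real.exp (-|x|) := integral_nonneg fun x => (Real.exp_pos _).le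
    positivity
  have hsub : (∫ x : ℝ, k (x - ζ) * g x) - ∑ j ∈ Finset.range m, a j * Complex.exp (j * ζ) =
      ∫ x : ℝ, k (x - ζ) *
        (g x - ∑ j ∈ Finset.range m, a j / flatMoment n ρ j * Complex.exp (j * x)) := by
    rw [Finset.sum_congr rfl fun j _ => ((hterm j ζ hζ).2).symm,
      ← integral_finsetSum _ fun j _ => (hterm j ζ hζ).1,
      ← integral_sub (integrable_convolution hkd hkb0 hgm hg0 hζ)
        (integrable_finsetSum _ fun j _ => (hterm j ζ hζ).1)]
    congr 1; funext x
    rw [mul_sub, Finset.mul_sum]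
  rw [hsub]
  have hle : ∀ x : ℝ, ‖k (x - ζ) *
      (g x - ∑ j ∈ Finset.range m, a j / flatMoment n ρ j * Complex.exp (j * x))‖ ≤
      2 * (C * c) * (2 * (B * B')) ^ m * (D ^ (2 * m + 3) * (∏ k ∈ Finset.range m, n k)) *
        Real.exp (m * ζ.re) * Real.exp (-|x - ζ.re|) := fun x => by
    have h1 := hkb m _ (ofReal_sub_mem_strip hζ x)
    have hre : ((m : ℂ) * ((x : ℂ) - ζ)).re = m * (x - ζ.re) := by simp
    have hre' : ((x : ℂ) - ζ).re = x - ζ.re := by simp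
    rw [norm_mul, Complex.norm_exp, hre, hre'] at h1
    rw [norm_mul]
    calc _ ≤ ‖k (x - ζ)‖ * (2 * (C * c) * (2 * (B * B')) ^ m * Real.exp (m * x)) := by
          gcongr; exact hg m x
      _ = 2 * (C * c) * (2 * (B * B')) ^ m *
          (‖k (x - ζ)‖ * Real.exp (m * (x - ζ.re))) * Real.exp (m * ζ.re) := by
          rw [show (m : ℝ) * x = m * (x - ζ.re) + m * ζ.re by ring, Real.exp_add]; ring
      _ ≤ 2 * (C * c) * (2 * (B * B')) ^ m *
          (D ^ (2 * m + 3) * (∏ k ∈ Finset.range m, n k) * Real.exp (-|x - ζ.re|)) *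
          Real.exp (m * ζ.re) :=
        mul_le_mul_of_nonneg_right (mul_le_mul_of_nonneg_left h1 (by positivity))
          (Real.exp_pos _).le
      _ = _ := by ring
  refine (norm_integral_le_of_norm_le
    ((integrable_exp_neg_abs.comp_sub_right ζ.re).const_mul _) (ae_of_all _ hle)).trans_eq ?_
  rw [integral_const_mul, integral_sub_right_eq_self (fun x : ℝ => Real.exp (-|x|)), mul_pow,
    pow_add, pow_mul]
  ring

section Sectors

variable {γ γ' : ℝ} {z : ℂ}

lemma mem_slitPlane_of_mem_sector (hγ : γ < 2) (hz : z ∈ Sector γ) : z ∈ Complex.slitPlane := by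
  refine Complex.mem_slitPlane_iff_arg.2 ⟨fun h => ?_, hz.1⟩
  have := hz.2
  rw [h, abs_of_pos Real.pi_pos] at this
  nlinarith [Real.pi_pos]

lemma isOpen_sector (hγ : γ < 2) : IsOpen (Sector γ) := by
  refine isOpen_iff_mem_nhds.2 fun z hz => ?_
  have hc := (Complex.continuousAt_arg (mem_slitPlane_of_mem_sector hγ hz)).abs
  filter_upwards [hc.eventually_lt_const hz.2, isOpen_ne.mem_nhds hz.1] with w h1 h2
  exact ⟨h2, h1⟩

lemma sector_mono (h : γ ≤ γ') : Sector γ ⊆ Sector γ' := fun _ hz =>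
  ⟨hz.1, hz.2.trans_le (by gcongr)⟩

lemma log_mem_strip (hz : z ∈ Sector γ) : Complex.log z ∈ Strip (γ * Real.pi / 2) := by
  simpa [Strip, Complex.log_im] using hz.2

/-- A smaller sector is at a relative positive distance from the boundary of a larger one. -/
lemma exists_closedBall_subset_sector (h : γ < γ') (hγ' : γ' < 2) :
    ∃ ε : ℝ, 0 < ε ∧ ∀ z ∈ Sector γ, Metric.closedBall z (ε * ‖z‖) ⊆ Sector γ' := by
  have hpos : |Complex.arg 1| < (γ' - γ) * Real.pi / 2 := by
    rw [Complex.arg_one, abs_zero]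
    have := sub_pos.2 h
    positivity
  have hc := (Complex.continuousAt_arg Complex.one_mem_slitPlane).abs
  obtain ⟨δ, hδ, hδarg⟩ := Metric.eventually_nhds_iff.1
    ((hc.eventually_lt_const hpos).and (isOpen_ne.mem_nhds (one_ne_zero (α := ℂ))))
  refine ⟨δ / 2, by positivity, fun z hz y hy => ?_⟩
  have hz0 : 0 < ‖z‖ := norm_pos_iff.2 hz.1
  have hw : dist (y / z) 1 < δ := by
    have hy' : ‖y - z‖ ≤ δ / 2 * ‖z‖ := mem_closedBall_iff_norm.1 hy
    rw [dist_eq_norm, div_sub_one hz.1, norm_div, div_lt_iff₀ hz0]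
    nlinarith
  obtain ⟨harg, hw0⟩ := hδarg hw
  have hsum : |Complex.arg z + Complex.arg (y / z)| < γ' * Real.pi / 2 :=
    (abs_add_le _ _).trans_lt (by linarith [hz.2])
  have hlt : |Complex.arg z + Complex.arg (y / z)| < Real.pi := by nlinarith [Real.pi_pos]
  have hyz : y = z * (y / z) := (mul_div_cancel₀ y hz.1).symm
  rw [hyz]
  refine ⟨mul_ne_zero hz.1 hw0, ?_⟩
  rwa [Complex.arg_mul hz.1 hw0 ⟨(abs_lt.1 hlt).1, (abs_lt.1 hlt).2.le⟩]

end Sectors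

section Expansions

variable {f : ℂ → ℂ} {U : Set ℂ} {a : ℕ → ℂ} {z : ℂ} {ε Q : ℝ} {p : ℕ}

lemma norm_iteratedDeriv_remainder_le (hf : DifferentiableOn ℂ f U) (hε : 0 < ε) (hz : z ≠ 0)
    (hball : Metric.closedBall z (ε * ‖z‖) ⊆ U) (hQ : 0 ≤ Q)
    (hR : ∀ y ∈ U, ‖f y - ∑ j ∈ Finset.range p, a j * y ^ j‖ ≤ Q * ‖y‖ ^ p) (m : ℕ) :
    ‖iteratedDeriv m (fun y => f y - ∑ j ∈ Finset.range p, a j * y ^ j) z‖ ≤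
      (m.factorial : ℝ) * (Q * ((1 + ε) * ‖z‖) ^ p) / (ε * ‖z‖) ^ m := by
  have hz0 : 0 < ‖z‖ := norm_pos_iff.2 hz
  refine Complex.norm_iteratedDeriv_le_of_forall_mem_sphere_norm_le m (by positivity)
    (DifferentiableOn.diffContOnCl_ball (U := U) (hf.sub (by fun_prop)) hball) fun y hy => ?_
  refine (hR y (hball (Metric.sphere_subset_closedBall hy))).trans ?_
  have hy' : ‖y - z‖ = ε * ‖z‖ := mem_sphere_iff_norm.1 hy
  have : ‖y‖ ≤ (1 + ε) * ‖z‖ := by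
    linarith [norm_le_norm_add_norm_sub' y z]
  gcongr

lemma iteratedDeriv_remainder (hU : IsOpen U) (hf : DifferentiableOn ℂ f U) (hz : z ∈ U)
    (m : ℕ) :
    iteratedDeriv m (fun y => f y - ∑ j ∈ Finset.range p, a j * y ^ j) z =
      iteratedDeriv m f z -
        ∑ j ∈ Finset.range p, a j * ((j.descFactorial m : ℂ) * z ^ (j - m)) := by
  rw [iteratedDeriv_fun_sub (hf.analyticAt (hU.mem_nhds hz)).contDiffAt (by fun_prop),
    iteratedDeriv_fun_sum fun _ _ => by fun_prop]
  simp only [iteratedDeriv_const_mul_field, iteratedDeriv_pow]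

lemma sum_range_descFactorial_eq_zero (m : ℕ) :
    ∑ j ∈ Finset.range m, a j * ((j.descFactorial m : ℂ) * z ^ (j - m)) = 0 :=
  Finset.sum_eq_zero fun j hj => by
    rw [Nat.descFactorial_of_lt (Finset.mem_range.1 hj)]; simp

lemma sum_range_succ_descFactorial (m : ℕ) :
    ∑ j ∈ Finset.range (m + 1), a j * ((j.descFactorial m : ℂ) * z ^ (j - m)) =
      m.factorial * a m := by
  rw [Finset.sum_range_succ, sum_range_descFactorial_eq_zero, Nat.descFactorial_self]
  simp [mul_comm]

/-- A remainder estimate of order `m` bounds the `m`-th derivative. -/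
lemma norm_iteratedDeriv_le_of_remainder (hU : IsOpen U) (hf : DifferentiableOn ℂ f U)
    (hε : 0 < ε) (hz : z ≠ 0) (hball : Metric.closedBall z (ε * ‖z‖) ⊆ U) (hQ : 0 ≤ Q) {m : ℕ}
    (hR : ∀ y ∈ U, ‖f y - ∑ j ∈ Finset.range m, a j * y ^ j‖ ≤ Q * ‖y‖ ^ m) :
    ‖iteratedDeriv m f z‖ ≤ (m.factorial : ℝ) * Q * ((1 + ε) / ε) ^ m := by
  have hz0 : 0 < ‖z‖ := norm_pos_iff.2 hz
  have h := norm_iteratedDeriv_remainder_le hf hε hz hball hQ hR m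
  rw [iteratedDeriv_remainder hU hf (hball (Metric.mem_closedBall_self (by positivity))),
    sum_range_descFactorial_eq_zero, sub_zero] at h
  refine h.trans_eq ?_
  rw [div_pow, mul_pow, mul_pow]
  field_simp

/-- A remainder estimate of order `m + 1` controls the `m`-th derivative near the vertex. -/
lemma norm_iteratedDeriv_sub_le_of_remainder (hU : IsOpen U) (hf : DifferentiableOn ℂ f U)
    (hε : 0 < ε) (hz : z ≠ 0) (hball : Metric.closedBall z (ε * ‖z‖) ⊆ U) (hQ : 0 ≤ Q) {m : ℕ}
    (hR : ∀ y ∈ U, ‖f y - ∑ j ∈ Finset.range (m + 1), a j * y ^ j‖ ≤ Q * ‖y‖ ^ (m + 1)) :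
    ‖iteratedDeriv m f z - m.factorial * a m‖ ≤
      (m.factorial : ℝ) * Q * ((1 + ε) ^ (m + 1) / ε ^ m) * ‖z‖ := by
  have hz0 : 0 < ‖z‖ := norm_pos_iff.2 hz
  have h := norm_iteratedDeriv_remainder_le hf hε hz hball hQ hR m
  rw [iteratedDeriv_remainder hU hf (hball (Metric.mem_closedBall_self (by positivity))),
    sum_range_succ_descFactorial] at h
  refine h.trans_eq ?_
  rw [mul_pow, mul_pow, pow_succ ‖z‖]
  field_simp

end Expansions

/-- An expansion in a sector obtained from one in a strip by passing to the logarithm. -/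
lemma exists_asymptotic_in_sector {n : ℕ → ℝ} {ρ γ : ℝ} (hn : ∀ k, 0 < n k)
    (hmono : Monotone fun k : ℕ => ((k : ℝ) + 1) ^ (-γ) * n k) (hρ : 0 < ρ) (hρ2 : ρ < 2)
    (hργ : ρ < γ) (hnC : ∃ C, 1 ≤ C ∧ ∀ k, n k ≤ C ^ (k + 1)) {a : ℕ → ℂ} {C B : ℝ}
    (hC : 0 ≤ C) (hB : 1 ≤ B) (ha : ∀ j, ‖a j‖ ≤ C * B ^ j * ∏ k ∈ Finset.range j, n k) :
    ∃ f : ℂ → ℂ, DifferentiableOn ℂ f (Sector ρ) ∧ ∃ E K : ℝ, 0 ≤ E ∧ 0 < K ∧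
      ∀ m, ∀ z ∈ Sector ρ, ‖f z - ∑ j ∈ Finset.range m, a j * z ^ j‖ ≤
        E * K ^ m * (∏ k ∈ Finset.range m, n k) * ‖z‖ ^ m := by
  obtain ⟨F, hF, E, K, hE, hK, h⟩ := exists_asymptotic_in_strip hn hmono hρ hργ hnC hC hB ha
  refine ⟨fun z => F (Complex.log z), fun z hz => ?_, E, K, hE, hK, fun m z hz => ?_⟩
  · exact ((hF.differentiableAt ((isOpen_strip _).mem_nhds (log_mem_strip hz))).comp z
      (differentiableAt_id.clog (mem_slitPlane_of_mem_sector hρ2 hz))).differentiableWithinAt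
  · have hm := h m _ (log_mem_strip hz)
    simpa only [Complex.exp_nat_mul, Complex.exp_log hz.1, Complex.log_re, Real.exp_nat_mul,
      Real.exp_log (norm_pos_iff.2 hz.1)] using hm

/-- for strongly regular `M` and `0 < γ < min(γ(M), 2)` the Borel map on
the Beurling class `A⁻_M(S_γ)` is surjective: every sequence `λ` with
`|λ_j| ≤ C_σ σ^j j! M_j` for all `σ > 0` is the sequence of asymptotic derivatives at `0`
of some holomorphic `f` on `S_γ` lying in `A_{M,σ}(S_γ)` for every `σ > 0`. -/
theorem stmt16 (M : ℕ → ℝ) (hM : StronglyRegular M) (γ : ℝ)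
    (hγ0 : 0 < γ) (hγM : γ < growthIndex M) (hγ2 : γ < 2)
    (lam : ℕ → ℂ)
    (hlam : ∀ σ : ℝ, 0 < σ → ∃ C : ℝ,
      ∀ j : ℕ, ‖lam j‖ ≤ C * σ ^ j * (Nat.factorial j : ℝ) * M j) :
    ∃ f : ℂ → ℂ, DifferentiableOn ℂ f (Sector γ) ∧
      (∀ σ : ℝ, 0 < σ → ∃ C : ℝ, ∀ (j : ℕ), ∀ z ∈ Sector γ,
        ‖iteratedDerivWithin j f (Sector γ) z‖ ≤ C * σ ^ j * (Nat.factorial j : ℝ) * M j) ∧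
      (∀ j : ℕ, Filter.Tendsto (iteratedDerivWithin j f (Sector γ))
        (nhdsWithin 0 (Sector γ)) (nhds (lam j))) := by
  obtain ⟨A, hMpos, hM0, -, -, hA, hMA, -⟩ := hM
  obtain ⟨γ', ⟨-, hP⟩, hγγ'⟩ : ∃ γ' ∈ {γ : ℝ | 0 < γ ∧ PropertyP M γ}, γ < γ' := by
    refine exists_lt_of_lt_csSup (Set.nonempty_iff_ne_empty.2 fun h => ?_) hγM
    rw [growthIndex, h, Real.sSup_empty] at hγM
    exact hγM.not_gt hγ0
  obtain ⟨ρ, hγρ, hρ⟩ := exists_between (lt_min hγγ' hγ2)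
  have hρ2 : ρ < 2 := hρ.trans_le (min_le_right _ _)
  obtain ⟨γ₁, hργ₁, hγ₁⟩ := exists_between (hρ.trans_le (min_le_left _ _))
  have ha : ∀ σ : ℝ, 0 < σ → ∃ C, ∀ j, ‖lam j / (j.factorial : ℂ)‖ ≤ C * σ ^ j * M j :=
    fun σ hσ => by
      obtain ⟨C, hC⟩ := hlam σ hσ
      refine ⟨C, fun j => ?_⟩
      rw [norm_div, Complex.norm_natCast, div_le_iff₀ (by positivity)]
      exact (hC j).trans_eq (by ring)
  obtain ⟨n, hn, hmono, hnC, ⟨C, B, hC, hB, haN⟩, hNM⟩ :=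
    exists_intermediate_quotients hMpos hM0 hA hMA hP hγ₁ ha
  obtain ⟨f, hf, E, K, hE, hK, hR⟩ := exists_asymptotic_in_sector hn hmono (hγ0.trans hγρ) hρ2
    hργ₁ hnC hC.le hB haN
  obtain ⟨ε, hε, hball⟩ := exists_closedBall_subset_sector hγρ hρ2
  have hQ : ∀ m, 0 ≤ E * K ^ m * ∏ k ∈ Finset.range m, n k := fun m =>
    mul_nonneg (by positivity) (Finset.prod_nonneg fun k _ => (hn k).le)
  have hderiv := fun j => iteratedDerivWithin_of_isOpen (n := j) (f := f) (isOpen_sector hγ2)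
  refine ⟨f, hf.mono (sector_mono hγρ.le), fun σ hσ => ?_, fun m => ?_⟩
  · obtain ⟨D, hD⟩ := hNM (σ / (K * ((1 + ε) / ε))) (by positivity)
    refine ⟨E * D, fun m z hz => ?_⟩
    rw [hderiv m hz]
    calc ‖iteratedDeriv m f z‖
        ≤ m.factorial * (E * K ^ m * ∏ k ∈ Finset.range m, n k) * ((1 + ε) / ε) ^ m :=
          norm_iteratedDeriv_le_of_remainder (isOpen_sector hρ2) hf hε hz.1 (hball z hz) (hQ m)
            (hR m)
      _ ≤ m.factorial * (E * K ^ m * (D * (σ / (K * ((1 + ε) / ε))) ^ m * M m)) *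
          ((1 + ε) / ε) ^ m := by
          have := hD m
          gcongr
      _ = E * D * (K * ((1 + ε) / ε) * (σ / (K * ((1 + ε) / ε)))) ^ m * m.factorial * M m := by
          rw [mul_pow, mul_pow]; ring
      _ = E * D * σ ^ m * m.factorial * M m := by rw [mul_div_cancel₀ σ (by positivity)]
  · have hlim : Tendsto (fun z : ℂ => (m.factorial : ℝ) *
        (E * K ^ (m + 1) * ∏ k ∈ Finset.range (m + 1), n k) *
        ((1 + ε) ^ (m + 1) / ε ^ m) * ‖z‖) (𝓝[Sector γ] 0) (𝓝 0) := by
      refine Tendsto.mono_left ?_ nhdsWithin_le_nhds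
      simpa using (tendsto_norm_zero (E := ℂ)).const_mul _
    refine tendsto_iff_norm_sub_tendsto_zero.2 (squeeze_zero' (.of_forall fun _ => norm_nonneg _)
      ?_ hlim)
    filter_upwards [self_mem_nhdsWithin] with z hz
    have h := norm_iteratedDeriv_sub_le_of_remainder (isOpen_sector hρ2) hf hε hz.1 (hball z hz)
      (hQ (m + 1)) (hR (m + 1))
    rwa [mul_div_cancel₀ _ (Nat.cast_ne_zero.2 m.factorial_ne_zero), ← hderiv m hz] at h
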